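/- arXiv:1603.03874 — 3 statements merged into one kernel-verified Lean document; each statement's English description precedes it below -/
import Mathlib

section
/- Let C : [0,∞) → ℝ be a measurable bounded function. Then its mean value modification C̃ is infinitely differentiable (C^∞ smooth) on the open interval (0,∞). -/
open MeasureTheory Real

/-- The mean value modification of a transaction costs function `C`:
`C̃(ξ) = ∫₀^∞ C(ξx) x e^{-x²/2} dx`. -/
noncomputable def tildeC (C : ℝ → ℝ) (ξ : ℝ) : ℝ :=
  ∫ x in Set.Ioi (0:ℝ), C (ξ * x) * x * Real.exp (-x ^ 2 / 2)

lemma integrableOn_bounded_mul_exp_neg_mul_sq {f : ℝ → ℝ} (hf : Measurable f) {M : ℝ}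
    (hM : ∀ u > 0, |f u| ≤ M) {s : ℝ} (hs : 0 < s) :
    IntegrableOn (fun u => f u * u * exp (s * -u ^ 2)) (Set.Ioi 0) := by
  have h : IntegrableOn (fun u : ℝ => u * exp (-s * u ^ 2)) (Set.Ioi 0) :=
    (integrable_mul_exp_neg_mul_sq hs).integrableOn
  refine (h.bdd_mul (c := M) hf.aestronglyMeasurable ?_).congr (ae_of_all _ fun u => ?_)
  · exact (ae_restrict_iff' measurableSet_Ioi).2 (ae_of_all _ fun u hu => hM u hu)
  · simp [mul_assoc]

/-- The Laplace-type transform of a nonnegative bounded function is analytic, being a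
moment-generating function of `u ↦ -u²`. -/
lemma analyticOnNhd_integral_mul_exp_of_nonneg {f : ℝ → ℝ} (hf : Measurable f)
    (hf0 : ∀ u, 0 ≤ f u) {M : ℝ} (hM : ∀ u > 0, |f u| ≤ M) :
    AnalyticOnNhd ℝ (fun s => ∫ u in Set.Ioi (0:ℝ), f u * u * exp (s * -u ^ 2)) (Set.Ioi 0) := by
  set ν : Measure ℝ :=
    (volume.restrict (Set.Ioi 0)).withDensity fun u => ENNReal.ofReal (f u * u) with hν
  have hd : Measurable fun u : ℝ => ENNReal.ofReal (f u * u) := by fun_prop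
  have hlt : ∀ᵐ u : ℝ ∂volume.restrict (Set.Ioi 0), ENNReal.ofReal (f u * u) < ⊤ :=
    ae_of_all _ fun _ => ENNReal.ofReal_lt_top
  have hcongr : ∀ s : ℝ, ∀ u ∈ Set.Ioi (0:ℝ),
      (ENNReal.ofReal (f u * u)).toReal • exp (s * -u ^ 2) = f u * u * exp (s * -u ^ 2) := by
    intro s u hu
    rw [ENNReal.toReal_ofReal (mul_nonneg (hf0 u) (le_of_lt hu)), smul_eq_mul]
  have hmgf : (fun s => ∫ u in Set.Ioi (0:ℝ), f u * u * exp (s * -u ^ 2)) =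
      ProbabilityTheory.mgf (fun u : ℝ => -u ^ 2) ν := by
    ext s
    rw [ProbabilityTheory.mgf, hν, integral_withDensity_eq_integral_toReal_smul hd hlt]
    exact (setIntegral_congr_fun measurableSet_Ioi (hcongr s)).symm
  rw [hmgf]
  refine ProbabilityTheory.analyticOnNhd_mgf.mono (interior_maximal (fun s hs => ?_) isOpen_Ioi)
  rw [ProbabilityTheory.integrableExpSet, Set.mem_ofPred_eq, hν,
    integrable_withDensity_iff_integrable_smul' hd hlt]
  exact (integrableOn_congr_fun (hcongr s) measurableSet_Ioi).2
    (integrableOn_bounded_mul_exp_neg_mul_sq hf hM hs)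

lemma analyticOnNhd_integral_mul_exp {f : ℝ → ℝ} (hf : Measurable f) {M : ℝ}
    (hM : ∀ u > 0, |f u| ≤ M) :
    AnalyticOnNhd ℝ (fun s => ∫ u in Set.Ioi (0:ℝ), f u * u * exp (s * -u ^ 2)) (Set.Ioi 0) := by
  have hp : Measurable fun u => max (f u) 0 := hf.max measurable_const
  have hn : Measurable fun u => max (-f u) 0 := hf.neg.max measurable_const
  have hpM : ∀ u > 0, |max (f u) 0| ≤ M := fun u hu => by
    rw [abs_of_nonneg (le_max_right _ _)]
    exact max_le ((le_abs_self _).trans (hM u hu)) ((abs_nonneg _).trans (hM u hu))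
  have hnM : ∀ u > 0, |max (-f u) 0| ≤ M := fun u hu => by
    rw [abs_of_nonneg (le_max_right _ _)]
    exact max_le ((neg_le_abs _).trans (hM u hu)) ((abs_nonneg _).trans (hM u hu))
  refine ((analyticOnNhd_integral_mul_exp_of_nonneg hp (fun _ => le_max_right _ _) hpM).sub
    (analyticOnNhd_integral_mul_exp_of_nonneg hn (fun _ => le_max_right _ _) hnM)).congr
    isOpen_Ioi fun s hs => ?_
  simp only [Pi.sub_apply]
  rw [← integral_sub (integrableOn_bounded_mul_exp_neg_mul_sq hp hpM hs)
    (integrableOn_bounded_mul_exp_neg_mul_sq hn hnM hs)]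
  congr 1 with u
  rw [← sub_mul, ← sub_mul, max_zero_sub_eq_self]

/-- The substitution `u = ξ x` in the mean value modification. -/
lemma tildeC_eq (C : ℝ → ℝ) {ξ : ℝ} (hξ : 0 < ξ) :
    tildeC C ξ =
      (ξ ^ 2)⁻¹ * ∫ u in Set.Ioi (0:ℝ), C u * u * exp ((2 * ξ ^ 2)⁻¹ * -u ^ 2) := by
  have h := integral_comp_mul_left_Ioi
    (fun u => C u * u * exp ((2 * ξ ^ 2)⁻¹ * -u ^ 2)) 0 hξ
  rw [mul_zero, smul_eq_mul] at h
  have hξ' := hξ.ne'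
  calc tildeC C ξ
      = ∫ x in Set.Ioi (0:ℝ),
          ξ⁻¹ * (C (ξ * x) * (ξ * x) * exp ((2 * ξ ^ 2)⁻¹ * -(ξ * x) ^ 2)) := by
        rw [tildeC]
        congr 1 with x
        have he : (2 * ξ ^ 2)⁻¹ * -(ξ * x) ^ 2 = -x ^ 2 / 2 := by field_simp
        rw [he]
        field_simp
    _ = _ := by
        rw [integral_const_mul, h]
        field_simp

/-- For a measurable bounded transaction costs function `C`, the mean
value modification `C̃` is `C^∞` smooth on the open interval `(0,∞)`. -/
theorem tildeC_smooth (C : ℝ → ℝ) (hmeas : Measurable C)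
    (M : ℝ) (hbdd : ∀ ξ ≥ (0:ℝ), |C ξ| ≤ M) :
    ContDiffOn ℝ (⊤ : ℕ∞) (tildeC C) (Set.Ioi 0) := by
  have hG : ContDiffOn ℝ (⊤ : ℕ∞)
      (fun s => ∫ u in Set.Ioi (0:ℝ), C u * u * exp (s * -u ^ 2)) (Set.Ioi 0) :=
    (analyticOnNhd_integral_mul_exp hmeas fun u hu => hbdd u hu.le).contDiffOn
      (uniqueDiffOn_Ioi 0)
  have hsq : ContDiffOn ℝ (⊤ : ℕ∞) (fun ξ : ℝ => (ξ ^ 2)⁻¹) (Set.Ioi 0) :=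
    (contDiff_id.pow 2).contDiffOn.inv fun ξ hξ => pow_ne_zero 2 (ne_of_gt hξ)
  have hs : ContDiffOn ℝ (⊤ : ℕ∞) (fun ξ : ℝ => (2 * ξ ^ 2)⁻¹) (Set.Ioi 0) :=
    (contDiff_const.mul (contDiff_id.pow 2)).contDiffOn.inv fun ξ hξ =>
      mul_ne_zero two_ne_zero (pow_ne_zero 2 (ne_of_gt hξ))
  refine (hsq.mul (hG.comp hs fun ξ hξ => ?_)).congr fun ξ hξ => tildeC_eq C hξ
  have : 0 < ξ := hξ
  exact Set.mem_Ioi.2 (by positivity)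
end

section
/- Let C : [0,∞) → ℝ be a measurable bounded function and let C̃ be its mean value modification. Then for every ξ > 0 one has the identity C̃(ξ) + ξ C̃′(ξ) = ∫₀^∞ C(ξx) (x³ − x) e^{-x²/2} dx; in particular ξ C̃′(ξ) = −2 C̃(ξ) + ∫₀^∞ C(ξx) x³ e^{-x²/2} dx. -/
open MeasureTheory Real

/-- The moments `∫₀^∞ C(y) yⁿ e^{-s y²} dy` of `C` against a Gaussian weight. -/
noncomputable def gaussianMoment (C : ℝ → ℝ) (n : ℕ) (s : ℝ) : ℝ :=
  ∫ y in Set.Ioi (0:ℝ), C y * y ^ n * Real.exp (-s * y ^ 2)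

lemma integrableOn_pow_mul_exp_neg_mul_sq (n : ℕ) {s : ℝ} (hs : 0 < s) :
    IntegrableOn (fun y : ℝ => y ^ n * Real.exp (-s * y ^ 2)) (Set.Ioi 0) := by
  have hn : (-1 : ℝ) < n := by
    have : (0 : ℝ) ≤ n := n.cast_nonneg
    linarith
  simpa only [Real.rpow_natCast] using integrableOn_rpow_mul_exp_neg_mul_sq hs hn

lemma integrableOn_mul_pow_mul_exp_neg_mul_sq {C : ℝ → ℝ} (hmeas : Measurable C)
    {M : ℝ} (hbdd : ∀ y ≥ (0:ℝ), |C y| ≤ M) (n : ℕ) {s : ℝ} (hs : 0 < s) :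
    IntegrableOn (fun y : ℝ => C y * y ^ n * Real.exp (-s * y ^ 2)) (Set.Ioi 0) := by
  refine ((integrableOn_pow_mul_exp_neg_mul_sq n hs).const_mul M).mono'
    (by fun_prop) ?_
  filter_upwards [ae_restrict_mem measurableSet_Ioi] with y hy
  have hy' : (0:ℝ) < y := hy
  rw [mul_assoc, norm_mul, Real.norm_eq_abs, Real.norm_of_nonneg (by positivity)]
  exact mul_le_mul_of_nonneg_right (hbdd y hy'.le) (by positivity)

lemma hasDerivAt_gaussianMoment {C : ℝ → ℝ} (hmeas : Measurable C)
    {M : ℝ} (hbdd : ∀ y ≥ (0:ℝ), |C y| ≤ M) (n : ℕ) {s : ℝ} (hs : 0 < s) :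
    HasDerivAt (gaussianMoment C n) (-gaussianMoment C (n + 2) s) s := by
  have hs2 : 0 < s / 2 := by positivity
  have key := (hasDerivAt_integral_of_dominated_loc_of_deriv_le
    (μ := volume.restrict (Set.Ioi (0:ℝ)))
    (F := fun t y => C y * y ^ n * Real.exp (-t * y ^ 2))
    (F' := fun t y => -(C y * y ^ (n + 2) * Real.exp (-t * y ^ 2)))
    (bound := fun y => M * (y ^ (n + 2) * Real.exp (-(s / 2) * y ^ 2)))
    (x₀ := s) (Ioi_mem_nhds (half_lt_self hs))
    (Filter.Eventually.of_forall fun t => by fun_prop)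
    (integrableOn_mul_pow_mul_exp_neg_mul_sq hmeas hbdd n hs)
    (by fun_prop) ?_
    ((integrableOn_pow_mul_exp_neg_mul_sq (n + 2) hs2).const_mul M) ?_).2
  · rw [integral_neg] at key
    exact key
  · filter_upwards [ae_restrict_mem measurableSet_Ioi] with y hy t ht
    have hy' : (0:ℝ) < y := hy
    have ht' : s / 2 < t := ht
    have hM : 0 ≤ M := (abs_nonneg _).trans (hbdd y hy'.le)
    rw [norm_neg, mul_assoc, norm_mul, Real.norm_eq_abs, Real.norm_of_nonneg (by positivity)]
    have hC := hbdd y hy'.le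
    gcongr
  · filter_upwards with y t _
    have h1 : HasDerivAt (fun t : ℝ => -t * y ^ 2) (-1 * y ^ 2) t :=
      (hasDerivAt_id t).neg.mul_const _
    refine (h1.exp.const_mul (C y * y ^ n)).congr_deriv ?_
    ring

lemma integral_comp_mul_gaussian_eq (C : ℝ → ℝ) (n : ℕ) {ξ : ℝ} (hξ : 0 < ξ) :
    ∫ x in Set.Ioi (0:ℝ), C (ξ * x) * x ^ n * Real.exp (-x ^ 2 / 2)
      = (ξ ^ (n + 1))⁻¹ * gaussianMoment C n ((2 * ξ ^ 2)⁻¹) := by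
  have h := integral_comp_mul_left_Ioi
    (fun y => C y * y ^ n * Real.exp (-(2 * ξ ^ 2)⁻¹ * y ^ 2)) 0 hξ
  rw [mul_zero, smul_eq_mul] at h
  rw [pow_succ, mul_inv, mul_assoc, gaussianMoment, ← h, ← integral_const_mul]
  congr 1 with x
  have he : -(2 * ξ ^ 2)⁻¹ * (ξ * x) ^ 2 = -x ^ 2 / 2 := by field_simp
  rw [he, mul_pow]
  field_simp

lemma integrableOn_comp_mul_gaussian {C : ℝ → ℝ} (hmeas : Measurable C)
    {M : ℝ} (hbdd : ∀ y ≥ (0:ℝ), |C y| ≤ M) (n : ℕ) {ξ : ℝ} (hξ : 0 < ξ) :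
    IntegrableOn (fun x : ℝ => C (ξ * x) * x ^ n * Real.exp (-x ^ 2 / 2)) (Set.Ioi 0) := by
  convert integrableOn_mul_pow_mul_exp_neg_mul_sq (C := fun x => C (ξ * x)) (by fun_prop)
    (fun y hy => hbdd (ξ * y) (mul_nonneg hξ.le hy)) n (s := 1 / 2) (by norm_num) using 4
  ring

lemma tildeC_eq_gaussianMoment (C : ℝ → ℝ) {ξ : ℝ} (hξ : 0 < ξ) :
    tildeC C ξ = (ξ ^ 2)⁻¹ * gaussianMoment C 1 ((2 * ξ ^ 2)⁻¹) := by
  simpa only [pow_one, Nat.reduceAdd] using! integral_comp_mul_gaussian_eq C 1 hξ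

lemma mul_deriv_tildeC {C : ℝ → ℝ} (hmeas : Measurable C)
    {M : ℝ} (hbdd : ∀ y ≥ (0:ℝ), |C y| ≤ M) {ξ : ℝ} (hξ : 0 < ξ) :
    ξ * deriv (tildeC C) ξ = -2 * tildeC C ξ
      + ∫ x in Set.Ioi (0:ℝ), C (ξ * x) * x ^ 3 * Real.exp (-x ^ 2 / 2) := by
  have hsq : HasDerivAt (fun t : ℝ => t ^ 2) (2 * ξ) ξ := by
    simpa using hasDerivAt_pow 2 ξ
  have hs := (hsq.const_mul 2).fun_inv (by positivity)
  have hG := (hasDerivAt_gaussianMoment hmeas hbdd 1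
    (s := (2 * ξ ^ 2)⁻¹) (by positivity)).comp ξ hs
  have hd := ((hsq.fun_inv (by positivity)).mul hG).congr_of_eventuallyEq
    (f₁ := tildeC C) (by
      filter_upwards [Ioi_mem_nhds hξ] with t ht
      exact tildeC_eq_gaussianMoment C ht)
  rw [hd.deriv, tildeC_eq_gaussianMoment C hξ, integral_comp_mul_gaussian_eq C 3 hξ]
  simp only [Function.comp_apply, Nat.reduceAdd]
  field_simp

/-- For a measurable bounded transaction costs function `C` and every
`ξ > 0`, `C̃(ξ) + ξ C̃′(ξ) = ∫₀^∞ C(ξx)(x³ − x) e^{-x²/2} dx`; in particular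
`ξ C̃′(ξ) = −2C̃(ξ) + ∫₀^∞ C(ξx) x³ e^{-x²/2} dx`. -/
theorem tildeC_deriv_identity (C : ℝ → ℝ) (hmeas : Measurable C)
    (M : ℝ) (hbdd : ∀ ξ ≥ (0:ℝ), |C ξ| ≤ M) :
    ∀ ξ > (0:ℝ),
      (tildeC C ξ + ξ * deriv (tildeC C) ξ
        = ∫ x in Set.Ioi (0:ℝ), C (ξ * x) * (x ^ 3 - x) * Real.exp (-x ^ 2 / 2)) ∧
      (ξ * deriv (tildeC C) ξ
        = -2 * tildeC C ξ + ∫ x in Set.Ioi (0:ℝ), C (ξ * x) * x ^ 3 * Real.exp (-x ^ 2 / 2)) := by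
  intro ξ hξ
  have hderiv := mul_deriv_tildeC hmeas hbdd hξ
  refine ⟨?_, hderiv⟩
  have h3 := integrableOn_comp_mul_gaussian hmeas hbdd 3 hξ
  have h1 := integrableOn_comp_mul_gaussian hmeas hbdd 1 hξ
  have hsub : ∫ x in Set.Ioi (0:ℝ), C (ξ * x) * (x ^ 3 - x) * Real.exp (-x ^ 2 / 2)
      = (∫ x in Set.Ioi (0:ℝ), C (ξ * x) * x ^ 3 * Real.exp (-x ^ 2 / 2)) - tildeC C ξ := by
    simp only [pow_one] at h1
    rw [tildeC, ← integral_sub h3 h1]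
    congr 1 with x
    ring
  rw [hsub, hderiv]
  ring
end

section
/- Let C₀ > 0, κ > 0 and 0 ≤ ξ₋ < ξ₊ < ∞ be constants with C₀ − κ(ξ₊ − ξ₋) > 0, and let C : [0,∞) → ℝ be the piecewise linear nonincreasing transaction costs function defined by C(ξ) = C₀ for 0 ≤ ξ ≤ ξ₋, C(ξ) = C₀ − κ(ξ − ξ₋) for ξ₋ ≤ ξ ≤ ξ₊, and C(ξ) = C₀ − κ(ξ₊ − ξ₋) for ξ ≥ ξ₊. Then its mean value modification satisfies C̃(ξ) = C₀ − κ ξ ∫_{ξ₋/ξ}^{ξ₊/ξ} e^{-x²/2} dx for all ξ > 0. -/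
open MeasureTheory Real intervalIntegral

theorem hasDerivAt_exp_neg_sq_div_two (x : ℝ) :
    HasDerivAt (fun x : ℝ => Real.exp (-x ^ 2 / 2)) (-(x * Real.exp (-x ^ 2 / 2))) x := by
  have h := (((hasDerivAt_pow 2 x).neg).div_const 2).exp
  refine h.congr_deriv ?_
  simp only [Pi.neg_apply]
  push_cast
  ring

theorem integral_affine_mul_mul_exp_neg_sq_div_two (α β p q : ℝ) :
    ∫ x in p..q, (α + β * x) * x * Real.exp (-x ^ 2 / 2) =
      (α + β * p) * Real.exp (-p ^ 2 / 2) - (α + β * q) * Real.exp (-q ^ 2 / 2)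
        + β * ∫ x in p..q, Real.exp (-x ^ 2 / 2) := by
  have hderiv : ∀ x ∈ Set.uIcc p q,
      HasDerivAt (fun x : ℝ => -((α + β * x) * Real.exp (-x ^ 2 / 2)))
        ((α + β * x) * x * Real.exp (-x ^ 2 / 2) - β * Real.exp (-x ^ 2 / 2)) x := by
    intro x _
    have h := ((((hasDerivAt_id x).const_mul β).const_add α).mul
      (hasDerivAt_exp_neg_sq_div_two x)).neg
    refine h.congr_deriv ?_
    simp only [id]
    ring
  have h := integral_eq_sub_of_hasDerivAt hderiv
    (Continuous.intervalIntegrable (by fun_prop) p q)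
  rw [intervalIntegral.integral_sub (Continuous.intervalIntegrable (by fun_prop) p q)
    (Continuous.intervalIntegrable (by fun_prop) p q),
    intervalIntegral.integral_const_mul] at h
  linarith

theorem integrable_mul_exp_neg_sq_div_two :
    Integrable (fun x : ℝ => x * Real.exp (-x ^ 2 / 2)) := by
  refine (integrable_mul_exp_neg_mul_sq (b := 1 / 2) (by norm_num)).congr (.of_forall fun x => ?_)
  simp only
  congr 2
  ring

theorem tendsto_exp_neg_sq_div_two_atTop :
    Filter.Tendsto (fun x : ℝ => Real.exp (-x ^ 2 / 2)) Filter.atTop (nhds 0) := by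
  refine Real.tendsto_exp_atBot.comp ?_
  have h : Filter.Tendsto (fun x : ℝ => x ^ 2 / 2) Filter.atTop Filter.atTop :=
    (Filter.tendsto_pow_atTop two_ne_zero).atTop_div_const two_pos
  refine (Filter.tendsto_neg_atTop_atBot.comp h).congr fun x => ?_
  simp only [Function.comp_apply]
  ring

theorem integral_Ioi_mul_exp_neg_sq_div_two (b : ℝ) :
    ∫ x in Set.Ioi b, x * Real.exp (-x ^ 2 / 2) = Real.exp (-b ^ 2 / 2) := by
  have h := integral_Ioi_of_hasDerivAt_of_tendsto' (a := b) (m := -0)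
    (fun x _ => ((hasDerivAt_exp_neg_sq_div_two x).neg).congr_deriv (neg_neg _))
    integrable_mul_exp_neg_sq_div_two.integrableOn
    tendsto_exp_neg_sq_div_two_atTop.neg
  simpa using h

/-- For the piecewise linear nonincreasing transaction costs function
with parameters `C₀ > 0`, `κ > 0`, `0 ≤ ξ₋ < ξ₊ < ∞` and `C̲₀ = C₀ − κ(ξ₊ − ξ₋) > 0`,
the mean value modification satisfies
`C̃(ξ) = C₀ − κ ξ ∫_{ξ₋/ξ}^{ξ₊/ξ} e^{-x²/2} dx` for all `ξ > 0`. -/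
theorem tildeC_piecewise_linear (C₀ κ ξm ξp : ℝ)
    (hC₀ : 0 < C₀) (hκ : 0 < κ) (hξm : 0 ≤ ξm) (hlt : ξm < ξp)
    (hunder : 0 < C₀ - κ * (ξp - ξm))
    (C : ℝ → ℝ)
    (hC : ∀ ξ ≥ (0:ℝ), C ξ =
      if ξ ≤ ξm then C₀
      else if ξ ≤ ξp then C₀ - κ * (ξ - ξm)
      else C₀ - κ * (ξp - ξm)) :
    ∀ ξ > (0:ℝ),
      tildeC C ξ = C₀ - κ * ξ * ∫ x in (ξm / ξ)..(ξp / ξ), Real.exp (-x ^ 2 / 2) := by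
  intro ξ hξ
  set a := ξm / ξ with ha
  set b := ξp / ξ with hb
  have ham : ξ * a = ξm := mul_div_cancel₀ ξm hξ.ne'
  have hbp : ξ * b = ξp := mul_div_cancel₀ ξp hξ.ne'
  have ha0 : 0 ≤ a := by positivity
  have hab : a < b := div_lt_div_of_pos_right hlt hξ
  have hleft : Set.EqOn (fun x => C (ξ * x) * x * Real.exp (-x ^ 2 / 2))
      (fun x => (C₀ + 0 * x) * x * Real.exp (-x ^ 2 / 2)) (Set.Ioc 0 a) := by
    intro x hx
    have hxa : ξ * x ≤ ξm := ham ▸ mul_le_mul_of_nonneg_left hx.2 hξ.le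
    simp [hC (ξ * x) (mul_nonneg hξ.le hx.1.le), hxa]
  have hmid : Set.EqOn (fun x => C (ξ * x) * x * Real.exp (-x ^ 2 / 2))
      (fun x => (C₀ + κ * ξm + -(κ * ξ) * x) * x * Real.exp (-x ^ 2 / 2)) (Set.Ioc a b) := by
    intro x hx
    have hxa : ξm < ξ * x := ham ▸ mul_lt_mul_of_pos_left hx.1 hξ
    have hxb : ξ * x ≤ ξp := hbp ▸ mul_le_mul_of_nonneg_left hx.2 hξ.le
    simp only [hC (ξ * x) (hξm.trans hxa.le), hxa.not_ge, hxb, if_true, if_false]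
    ring
  have hright : Set.EqOn (fun x => C (ξ * x) * x * Real.exp (-x ^ 2 / 2))
      (fun x => (C₀ - κ * (ξp - ξm)) * (x * Real.exp (-x ^ 2 / 2))) (Set.Ioi b) := by
    intro x hx
    have hxb : ξp < ξ * x := hbp ▸ mul_lt_mul_of_pos_left hx hξ
    simp only [hC (ξ * x) (by linarith), (hlt.trans hxb).not_ge, hxb.not_ge, if_false]
    ring
  have ileft : IntegrableOn (fun x => C (ξ * x) * x * Real.exp (-x ^ 2 / 2)) (Set.Ioc 0 a) :=
    (Continuous.integrableOn_Ioc (by fun_prop)).congr_fun hleft.symm measurableSet_Ioc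
  have imid : IntegrableOn (fun x => C (ξ * x) * x * Real.exp (-x ^ 2 / 2)) (Set.Ioc a b) :=
    (Continuous.integrableOn_Ioc (by fun_prop)).congr_fun hmid.symm measurableSet_Ioc
  have iright : IntegrableOn (fun x => C (ξ * x) * x * Real.exp (-x ^ 2 / 2)) (Set.Ioi b) :=
    IntegrableOn.congr_fun (integrable_mul_exp_neg_sq_div_two.const_mul _).integrableOn
      hright.symm measurableSet_Ioi
  have itail : IntegrableOn (fun x => C (ξ * x) * x * Real.exp (-x ^ 2 / 2)) (Set.Ioi a) :=
    Set.Ioc_union_Ioi_eq_Ioi hab.le ▸ imid.union iright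
  rw [tildeC, ← Set.Ioc_union_Ioi_eq_Ioi ha0,
    setIntegral_union (Set.Ioc_disjoint_Ioi le_rfl) measurableSet_Ioi ileft itail,
    ← Set.Ioc_union_Ioi_eq_Ioi hab.le,
    setIntegral_union (Set.Ioc_disjoint_Ioi le_rfl) measurableSet_Ioi imid iright,
    setIntegral_congr_fun measurableSet_Ioc hleft,
    setIntegral_congr_fun measurableSet_Ioc hmid,
    setIntegral_congr_fun measurableSet_Ioi hright,
    ← intervalIntegral.integral_of_le ha0, ← intervalIntegral.integral_of_le hab.le,
    integral_affine_mul_mul_exp_neg_sq_div_two, integral_affine_mul_mul_exp_neg_sq_div_two,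
    MeasureTheory.integral_const_mul, integral_Ioi_mul_exp_neg_sq_div_two, ← ham, ← hbp]
  have h0 : Real.exp (-(0:ℝ) ^ 2 / 2) = 1 := by norm_num
  rw [h0]
  ring
end
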